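/- For any initialization Y^{(0)} ∈ ℝ^{n×d}, there exists α' > 0 such that for every step-size parameter α ∈ (0, α'], the gradient descent iterations Y^{(t+1)} = Y^{(t)} − (α/2)·∇ℓ_node(Y^{(t)}) satisfy: the sequence {Y^{(t)}} remains bounded, the energy values ℓ_node(Y^{(t)}) are non-increasing and convergent, ‖∇ℓ_node(Y^{(t)})‖_F → 0 as t → ∞, and every accumulation point of {Y^{(t)}} is a stationary point of ℓ_node. -/

import Mathlib

open Matrix Filter

/-- The logistic sigmoid `σ(x) = 1/(1 + e^{−x})`. -/
noncomputable def sigmoid (x : ℝ) : ℝ := 1 / (1 + Real.exp (-x))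

/-- `Softplus(x) = log(1 + eˣ)`. -/
noncomputable def softplus (x : ℝ) : ℝ := Real.log (1 + Real.exp x)

/-- Frobenius norm `‖A‖_F = √(∑ᵢⱼ Aᵢⱼ²)`. -/
noncomputable def frobNorm {n d : ℕ} (A : Matrix (Fin n) (Fin d) ℝ) : ℝ :=
  Real.sqrt (∑ i, ∑ j, (A i j) ^ 2)

/-- The final node-embedding energy
`ℓ_node(Y) = tr[(Y−F)ᵀ P (Y−F)] + λ·tr(Yᵀ L̃ Y) + (λ_K/K)·Softplus(c − tr(Yᵀ L̃⁻ Y))`. -/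
noncomputable def lnode {n d : ℕ} (P Lt Ltneg : Matrix (Fin n) (Fin n) ℝ)
    (F : Matrix (Fin n) (Fin d) ℝ) (lam lamK : ℝ) (K : ℕ) (c : ℝ)
    (Y : Matrix (Fin n) (Fin d) ℝ) : ℝ :=
  ((Y - F)ᵀ * P * (Y - F)).trace + lam * (Yᵀ * Lt * Y).trace
    + (lamK / K) * softplus (c - (Yᵀ * Ltneg * Y).trace)

/-- The gradient of `ℓ_node`:
`∇ℓ_node(Y) = 2P(Y − F) + 2λ L̃ Y − (2λ_K/K)·σ(c − tr(Yᵀ L̃⁻ Y))·L̃⁻ Y`. -/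
noncomputable def lnodeGrad {n d : ℕ} (P Lt Ltneg : Matrix (Fin n) (Fin n) ℝ)
    (F : Matrix (Fin n) (Fin d) ℝ) (lam lamK : ℝ) (K : ℕ) (c : ℝ)
    (Y : Matrix (Fin n) (Fin d) ℝ) : Matrix (Fin n) (Fin d) ℝ :=
  (2 : ℝ) • (P * (Y - F)) + (2 * lam) • (Lt * Y)
    - (2 * lamK / K * sigmoid (c - (Yᵀ * Ltneg * Y).trace)) • (Ltneg * Y)

theorem sigmoid_pos (x : ℝ) : 0 < sigmoid x := by
  unfold sigmoid; positivity

theorem sigmoid_le_one (x : ℝ) : sigmoid x ≤ 1 := by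
  unfold sigmoid
  rw [div_le_one (by positivity)]
  linarith [Real.exp_pos (-x)]

theorem sigmoid_continuous : Continuous sigmoid := by
  unfold sigmoid
  refine continuous_const.div (by fun_prop) fun x => ?_
  positivity

theorem softplus_nonneg (x : ℝ) : 0 ≤ softplus x :=
  Real.log_nonneg (by linarith [Real.exp_pos x])

theorem softplus_add (a x : ℝ) :
    softplus (a + x) = softplus a + Real.log (1 + sigmoid a * (Real.exp x - 1)) := by
  have ha := Real.exp_pos a
  have h : 1 + Real.exp (a + x)
      = (1 + Real.exp a) * (1 + sigmoid a * (Real.exp x - 1)) := by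
    rw [sigmoid, Real.exp_neg, Real.exp_add]
    field_simp
    ring
  have hpos : 0 < 1 + sigmoid a * (Real.exp x - 1) := by
    nlinarith [sigmoid_pos a, sigmoid_le_one a, Real.exp_pos x,
      mul_pos (sigmoid_pos a) (Real.exp_pos x)]
  rw [softplus, h, Real.log_mul (by positivity) hpos.ne', softplus]

/-- The quadratic upper bound for the softplus at a point, with the sigmoid as its slope. -/
theorem softplus_add_le (a x : ℝ) :
    softplus (a + x) ≤ softplus a + sigmoid a * x + x ^ 2 := by
  have hs := sigmoid_pos a
  have hs1 := sigmoid_le_one a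
  have hex := Real.exp_pos x
  have hpos : 0 < 1 + sigmoid a * (Real.exp x - 1) := by
    nlinarith [mul_pos hs hex]
  rw [softplus_add]
  rcases le_or_gt |x| 1 with hx | hx
  · have h1 := Real.log_le_sub_one_of_pos hpos
    have h2 := (abs_le.1 (Real.abs_exp_sub_one_sub_id_le hx)).2
    nlinarith [sq_nonneg x]
  · rcases le_total 0 x with h0 | h0
    · rw [abs_of_nonneg h0] at hx
      have h1 : Real.log (1 + sigmoid a * (Real.exp x - 1)) ≤ x := by
        rw [Real.log_le_iff_le_exp hpos]
        nlinarith [Real.one_le_exp h0]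
      nlinarith [mul_nonneg hs.le h0]
    · rw [abs_of_nonpos h0] at hx
      have h1 : Real.log (1 + sigmoid a * (Real.exp x - 1)) ≤ 0 :=
        Real.log_nonpos hpos.le (by nlinarith [Real.exp_le_one_iff.2 h0])
      nlinarith

section Frobenius

attribute [local instance] Matrix.frobeniusNormedAddCommGroup Matrix.frobeniusNormedSpace

variable {n d : ℕ}

theorem frobNorm_eq_norm (A : Matrix (Fin n) (Fin d) ℝ) : frobNorm A = ‖A‖ := by
  rw [Matrix.frobenius_norm_def, frobNorm, Real.sqrt_eq_rpow]
  simp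

theorem trace_transpose_mul_eq_sum (A B : Matrix (Fin n) (Fin d) ℝ) :
    (Aᵀ * B).trace = ∑ i, ∑ j, A i j * B i j := by
  simp only [Matrix.trace, Matrix.diag, Matrix.mul_apply, Matrix.transpose_apply]
  exact Finset.sum_comm

theorem sq_norm_eq_sum (A : Matrix (Fin n) (Fin d) ℝ) : ‖A‖ ^ 2 = ∑ i, ∑ j, A i j ^ 2 := by
  rw [← frobNorm_eq_norm, frobNorm, Real.sq_sqrt (by positivity)]

theorem trace_transpose_mul_self_eq (A : Matrix (Fin n) (Fin d) ℝ) :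
    (Aᵀ * A).trace = ‖A‖ ^ 2 := by
  rw [trace_transpose_mul_eq_sum, sq_norm_eq_sum]
  simp only [sq]

theorem abs_trace_transpose_mul_le (A B : Matrix (Fin n) (Fin d) ℝ) :
    |(Aᵀ * B).trace| ≤ ‖A‖ * ‖B‖ := by
  apply abs_le_of_sq_le_sq _ (by positivity)
  rw [mul_pow, sq_norm_eq_sum, sq_norm_eq_sum, trace_transpose_mul_eq_sum]
  simp only [← Fintype.sum_prod_type']
  exact Finset.sum_mul_sq_le_sq_mul_sq _ _ _

theorem abs_trace_transpose_mul_mul_le (M : Matrix (Fin n) (Fin n) ℝ)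
    (A B : Matrix (Fin n) (Fin d) ℝ) :
    |(Aᵀ * (M * B)).trace| ≤ ‖M‖ * ‖B‖ * ‖A‖ := by
  have h1 := abs_trace_transpose_mul_le A (M * B)
  have h2 := Matrix.frobenius_norm_mul M B
  nlinarith [norm_nonneg A]

theorem trace_quadratic_add {M : Matrix (Fin n) (Fin n) ℝ} (hM : Mᵀ = M)
    (A H : Matrix (Fin n) (Fin d) ℝ) :
    ((A + H)ᵀ * M * (A + H)).trace
      = (Aᵀ * M * A).trace + 2 * (Hᵀ * (M * A)).trace + (Hᵀ * M * H).trace := by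
  have h : (Aᵀ * M * H).trace = (Hᵀ * (M * A)).trace := by
    rw [← Matrix.trace_transpose]
    simp [Matrix.transpose_mul, hM, Matrix.mul_assoc]
  simp only [Matrix.transpose_add, Matrix.add_mul, Matrix.mul_add, Matrix.trace_add, h]
  rw [Matrix.mul_assoc Hᵀ M A]
  ring

theorem trace_quadratic_nonneg {M : Matrix (Fin n) (Fin n) ℝ} (hM : M.PosSemidef)
    (A : Matrix (Fin n) (Fin d) ℝ) : 0 ≤ (Aᵀ * M * A).trace := by
  simpa using (hM.conjTranspose_mul_mul_same A).trace_nonneg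

variable {P Lt Ltneg : Matrix (Fin n) (Fin n) ℝ} {F : Matrix (Fin n) (Fin d) ℝ}
  {lam lamK c : ℝ} {K : ℕ}

theorem continuous_lnodeGrad : Continuous (lnodeGrad P Lt Ltneg F lam lamK K c) := by
  unfold lnodeGrad
  have hσ : Continuous fun Y : Matrix (Fin n) (Fin d) ℝ =>
      sigmoid (c - (Yᵀ * Ltneg * Y).trace) :=
    sigmoid_continuous.comp (by fun_prop)
  fun_prop

/-- The quadratic upper bound for the energy, up to the square of the change of the
quadratic form of the negative Laplacian. -/
theorem lnode_add_le (hP : Pᵀ = P) (hLt : Ltᵀ = Lt) (hLtneg : Ltneg.PosSemidef)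
    (hlam : 0 ≤ lam) (hlamK : 0 ≤ lamK) (Y H : Matrix (Fin n) (Fin d) ℝ) :
    lnode P Lt Ltneg F lam lamK K c (Y + H)
      ≤ lnode P Lt Ltneg F lam lamK K c Y
        + (Hᵀ * lnodeGrad P Lt Ltneg F lam lamK K c Y).trace
        + (‖P‖ + lam * ‖Lt‖ + lamK / K * (‖Ltneg‖ * (2 * ‖Y‖ + ‖H‖)) ^ 2) * ‖H‖ ^ 2 := by
  have hκ : 0 ≤ lamK / K := by positivity
  have hLs : Ltnegᵀ = Ltneg := by simpa using hLtneg.isHermitian.eq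
  have hgrad : (Hᵀ * lnodeGrad P Lt Ltneg F lam lamK K c Y).trace
      = 2 * (Hᵀ * (P * (Y - F))).trace + 2 * lam * (Hᵀ * (Lt * Y)).trace
        - 2 * (lamK / K) * sigmoid (c - (Yᵀ * Ltneg * Y).trace)
          * (Hᵀ * (Ltneg * Y)).trace := by
    simp only [lnodeGrad, Matrix.mul_add, Matrix.mul_sub, Matrix.mul_smul, Matrix.trace_add,
      Matrix.trace_sub, Matrix.trace_smul, smul_eq_mul]
    ring
  have hsub : Y + H - F = (Y - F) + H := by abel
  have hq := trace_quadratic_nonneg hLtneg H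
  have hPH := (abs_le.1 (abs_trace_transpose_mul_mul_le P H H)).2
  have hLH := (abs_le.1 (abs_trace_transpose_mul_mul_le Lt H H)).2
  have hqH := (abs_le.1 (abs_trace_transpose_mul_mul_le Ltneg H H)).2
  have hYH := abs_trace_transpose_mul_mul_le Ltneg H Y
  rw [← Matrix.mul_assoc] at hPH hLH hqH
  rw [hgrad, lnode, lnode, hsub, trace_quadratic_add hP, trace_quadratic_add hLt,
    trace_quadratic_add hLs]
  set q := (Yᵀ * Ltneg * Y).trace
  set b := (Hᵀ * (Ltneg * Y)).trace
  set r := (Hᵀ * Ltneg * H).trace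
  have hsp := softplus_add_le (c - q) (-(2 * b + r))
  have hsr : 0 ≤ sigmoid (c - q) * r := mul_nonneg (sigmoid_pos _).le hq
  have hx : (-(2 * b + r)) ^ 2 ≤ (‖Ltneg‖ * (2 * ‖Y‖ + ‖H‖) * ‖H‖) ^ 2 := by
    rw [neg_sq]
    apply sq_le_sq'
    · nlinarith [(abs_le.1 hYH).1, mul_nonneg (norm_nonneg Ltneg) (sq_nonneg ‖H‖)]
    · nlinarith [(abs_le.1 hYH).2]
  have hκsp : lamK / K * softplus (c - (q + 2 * b + r))
      ≤ lamK / K * (softplus (c - q) - sigmoid (c - q) * (2 * b)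
        + (‖Ltneg‖ * (2 * ‖Y‖ + ‖H‖) * ‖H‖) ^ 2) := by
    apply mul_le_mul_of_nonneg_left _ hκ
    rw [show c - (q + 2 * b + r) = c - q + -(2 * b + r) by ring]
    linarith
  have hLH' := mul_le_mul_of_nonneg_left hLH hlam
  linarith

theorem trace_quadratic_diag (hP : P.IsDiag) (A : Matrix (Fin n) (Fin d) ℝ) :
    (Aᵀ * P * A).trace = ∑ i, ∑ j, P i i * A i j ^ 2 := by
  rw [Matrix.mul_assoc, trace_transpose_mul_eq_sum]
  refine Finset.sum_congr rfl fun i _ => Finset.sum_congr rfl fun j _ => ?_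
  rw [← hP.diagonal_diag, Matrix.diagonal_mul]
  simp
  ring

theorem exists_mul_sq_norm_le_lnode (hPdiag : P.IsDiag) (hPpos : ∀ i, 0 < P i i)
    (hLt : Lt.PosSemidef) (hlam : 0 ≤ lam) (hlamK : 0 ≤ lamK) :
    ∃ p > 0, ∀ Y, p * ‖Y - F‖ ^ 2 ≤ lnode P Lt Ltneg F lam lamK K c Y := by
  obtain ⟨p, hp, hpP⟩ : ∃ p > 0, ∀ i, p ≤ P i i := by
    rcases isEmpty_or_nonempty (Fin n) with h | h
    · exact ⟨1, one_pos, fun i => h.elim i⟩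
    · obtain ⟨i, hi⟩ := Finite.exists_min fun i => P i i
      exact ⟨P i i, hPpos i, hi⟩
  refine ⟨p, hp, fun Y => ?_⟩
  have h1 : p * ‖Y - F‖ ^ 2 ≤ ((Y - F)ᵀ * P * (Y - F)).trace := by
    rw [trace_quadratic_diag hPdiag, sq_norm_eq_sum]
    simp only [Finset.mul_sum]
    gcongr with i _ j _
    exact hpP i
  have h2 := mul_nonneg hlam (trace_quadratic_nonneg hLt Y)
  have h3 : 0 ≤ lamK / K * softplus (c - (Yᵀ * Ltneg * Y).trace) :=
    mul_nonneg (by positivity) (softplus_nonneg _)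
  rw [lnode]
  linarith

/-- On a sublevel set of the energy, all small enough gradient steps decrease it sufficiently. -/
theorem exists_step_lnode_le (hPdiag : P.IsDiag) (hPpos : ∀ i, 0 < P i i)
    (hLt : Lt.PosSemidef) (hLtneg : Ltneg.PosSemidef) (hlam : 0 ≤ lam) (hlamK : 0 ≤ lamK)
    (e : ℝ) :
    ∃ R : ℝ, ∃ α' > (0 : ℝ), ∀ Y, lnode P Lt Ltneg F lam lamK K c Y ≤ e → ‖Y‖ ≤ R ∧
      ∀ α, 0 < α → α ≤ α' →
        lnode P Lt Ltneg F lam lamK K c (Y - (α / 2) • lnodeGrad P Lt Ltneg F lam lamK K c Y)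
          ≤ lnode P Lt Ltneg F lam lamK K c Y
            - α / 4 * ‖lnodeGrad P Lt Ltneg F lam lamK K c Y‖ ^ 2 := by
  obtain ⟨p, hp, hcoer⟩ := exists_mul_sq_norm_le_lnode (Ltneg := Ltneg) (F := F) (K := K)
    (c := c) hPdiag hPpos hLt hlam hlamK
  have hPs : Pᵀ = P := hPdiag.isSymm
  have hLts : Ltᵀ = Lt := by simpa using hLt.isHermitian.eq
  set g := lnodeGrad P Lt Ltneg F lam lamK K c with hg
  set R := √(e / p) + ‖F‖
  obtain ⟨G, hG⟩ := (isCompact_closedBall (0 : Matrix (Fin n) (Fin d) ℝ)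
    R).exists_bound_of_continuousOn (f := g) continuous_lnodeGrad.continuousOn
  set C := ‖P‖ + lam * ‖Lt‖ + lamK / K * (‖Ltneg‖ * (2 * R + G)) ^ 2
  have hC : 0 ≤ C := by positivity
  refine ⟨R, min 1 (1 / (C + 1)), by positivity, fun Y hY => ?_⟩
  have hYR : ‖Y‖ ≤ R := by
    have h1 : ‖Y - F‖ ≤ √(e / p) := by
      apply Real.le_sqrt_of_sq_le
      rw [le_div_iff₀ hp]
      linarith [hcoer Y]
    linarith [norm_le_norm_sub_add Y F]
  have hgG : ‖g Y‖ ≤ G := hG Y (by simpa using hYR)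
  refine ⟨hYR, fun α hα hα' => ?_⟩
  have hα1 : α ≤ 1 := hα'.trans (min_le_left _ _)
  have hαC : α * (C + 1) ≤ 1 := by
    rw [← le_div_iff₀ (by positivity)]
    exact hα'.trans (min_le_right _ _)
  have hstep := lnode_add_le (F := F) (c := c) (K := K) hPs hLts hLtneg hlam hlamK Y
    (-((α / 2) • g Y))
  have hnorm : ‖-((α / 2) • g Y)‖ = α / 2 * ‖g Y‖ := by
    rw [norm_neg, norm_smul, Real.norm_of_nonneg (by positivity)]
  have hip : ((-((α / 2) • g Y))ᵀ * g Y).trace = -(α / 2 * ‖g Y‖ ^ 2) := by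
    simp [trace_transpose_mul_self_eq]
  rw [← sub_eq_add_neg, ← hg, hip, hnorm] at hstep
  have hHG : α / 2 * ‖g Y‖ ≤ G := by nlinarith [norm_nonneg (g Y)]
  have hCle : ‖P‖ + lam * ‖Lt‖ + lamK / K * (‖Ltneg‖ * (2 * ‖Y‖ + α / 2 * ‖g Y‖)) ^ 2 ≤ C := by
    simp only [C]
    gcongr
  have hquad : (‖P‖ + lam * ‖Lt‖ + lamK / K * (‖Ltneg‖ * (2 * ‖Y‖ + α / 2 * ‖g Y‖)) ^ 2)
      * (α / 2 * ‖g Y‖) ^ 2 ≤ α / 4 * ‖g Y‖ ^ 2 := by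
    calc _ ≤ C * (α / 2 * ‖g Y‖) ^ 2 := by gcongr
      _ = (α * C) * (α / 4 * ‖g Y‖ ^ 2) := by ring
      _ ≤ 1 * (α / 4 * ‖g Y‖ ^ 2) := by gcongr; nlinarith
      _ = _ := one_mul _
  linarith

theorem lnodeGrad_eq_zero_of_tendsto {Y : ℕ → Matrix (Fin n) (Fin d) ℝ}
    {Z : Matrix (Fin n) (Fin d) ℝ}
    (hgrad : Tendsto (fun t => frobNorm (lnodeGrad P Lt Ltneg F lam lamK K c (Y t)))
      atTop (nhds 0))
    (hY : Tendsto (fun t => frobNorm (Y t - Z)) atTop (nhds 0)) :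
    lnodeGrad P Lt Ltneg F lam lamK K c Z = 0 := by
  simp only [frobNorm_eq_norm] at hgrad hY
  exact tendsto_nhds_unique
    ((continuous_lnodeGrad.tendsto Z).comp (tendsto_iff_norm_sub_tendsto_zero.2 hY))
    (tendsto_zero_iff_norm_tendsto_zero.2 hgrad)

end Frobenius

/-- for any initialization `Y⁽⁰⁾` there exists `α' > 0` such that for
every step-size parameter `α ∈ (0, α']`, the gradient descent iterations
`Y^{(t+1)} = Y^{(t)} − (α/2)·∇ℓ_node(Y^{(t)})` satisfy: the sequence remains
bounded, the energy values are non-increasing and convergent,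
`‖∇ℓ_node(Y^{(t)})‖_F → 0`, and every accumulation point of the sequence is a
stationary point of `ℓ_node`. -/
theorem lnode_gradient_descent_convergence {n d : ℕ}
    (P Lt Ltneg : Matrix (Fin n) (Fin n) ℝ)
    (hPdiag : P.IsDiag) (hPpos : ∀ i, 0 < P i i)
    (hLt : Lt.PosSemidef) (hLtneg : Ltneg.PosSemidef)
    (F : Matrix (Fin n) (Fin d) ℝ)
    (lam lamK : ℝ) (hlam : 0 < lam) (hlamK : 0 ≤ lamK)
    (K : ℕ) (hK : 1 ≤ K) (c : ℝ)
    (Y0 : Matrix (Fin n) (Fin d) ℝ) :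
    ∃ α' > (0 : ℝ), ∀ α : ℝ, 0 < α → α ≤ α' →
      ∀ Yseq : ℕ → Matrix (Fin n) (Fin d) ℝ,
        Yseq 0 = Y0 →
        (∀ t, Yseq (t + 1) =
            Yseq t - (α / 2) • lnodeGrad P Lt Ltneg F lam lamK K c (Yseq t)) →
        (∃ b : ℝ, ∀ t, frobNorm (Yseq t) ≤ b) ∧
        (∀ t, lnode P Lt Ltneg F lam lamK K c (Yseq (t + 1)) ≤
            lnode P Lt Ltneg F lam lamK K c (Yseq t)) ∧
        (∃ limit : ℝ, Tendsto (fun t => lnode P Lt Ltneg F lam lamK K c (Yseq t))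
            atTop (nhds limit)) ∧
        Tendsto (fun t => frobNorm (lnodeGrad P Lt Ltneg F lam lamK K c (Yseq t)))
          atTop (nhds 0) ∧
        (∀ Z : Matrix (Fin n) (Fin d) ℝ,
          (∃ φ : ℕ → ℕ, StrictMono φ ∧
            Tendsto (fun t => frobNorm (Yseq (φ t) - Z)) atTop (nhds 0)) →
          lnodeGrad P Lt Ltneg F lam lamK K c Z = 0) := by
  obtain ⟨R, α', hα', hdesc⟩ := exists_step_lnode_le (F := F) (c := c) (K := K)
    hPdiag hPpos hLt hLtneg hlam.le hlamK (lnode P Lt Ltneg F lam lamK K c Y0)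
  obtain ⟨p, hp, hcoer⟩ := exists_mul_sq_norm_le_lnode (Ltneg := Ltneg) (F := F) (K := K)
    (c := c) hPdiag hPpos hLt hlam.le hlamK
  refine ⟨α', hα', fun α hα hαα' Y hY0 hY => ?_⟩
  simp only [← frobNorm_eq_norm] at hdesc hcoer
  set ℓ := lnode P Lt Ltneg F lam lamK K c
  set g := lnodeGrad P Lt Ltneg F lam lamK K c
  have hsub : ∀ t, ℓ (Y t) ≤ ℓ Y0 := by
    intro t
    induction t with
    | zero => rw [hY0]
    | succ t ih =>
      have := (hdesc _ ih).2 α hα hαα'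
      rw [hY]
      nlinarith [mul_nonneg hα.le (sq_nonneg (frobNorm (g (Y t))))]
  have hstep : ∀ t, ℓ (Y (t + 1)) ≤ ℓ (Y t) - α / 4 * frobNorm (g (Y t)) ^ 2 := by
    intro t
    rw [hY]
    exact (hdesc _ (hsub t)).2 α hα hαα'
  have hmono : ∀ t, ℓ (Y (t + 1)) ≤ ℓ (Y t) := fun t => by
    nlinarith [hstep t, mul_nonneg hα.le (sq_nonneg (frobNorm (g (Y t))))]
  have hbdd : BddBelow (Set.range fun t => ℓ (Y t)) := by
    refine ⟨0, ?_⟩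
    rintro _ ⟨t, rfl⟩
    exact (mul_nonneg hp.le (sq_nonneg _)).trans (hcoer (Y t))
  have hlim := tendsto_atTop_ciInf (antitone_nat_of_succ_le hmono) hbdd
  have hgrad : Tendsto (fun t => frobNorm (g (Y t))) atTop (nhds 0) := by
    have hdiff := ((hlim.sub (hlim.comp (tendsto_add_atTop_nat 1))).const_mul (4 / α)).sqrt
    simp only [sub_self, mul_zero, Real.sqrt_zero] at hdiff
    refine squeeze_zero (fun t => Real.sqrt_nonneg _) (fun t => ?_) hdiff
    apply Real.le_sqrt_of_sq_le
    simp only [Function.comp_apply]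
    rw [div_mul_eq_mul_div, le_div_iff₀ hα]
    linarith [hstep t]
  refine ⟨⟨R, fun t => (hdesc _ (hsub t)).1⟩, hmono, ⟨_, hlim⟩, hgrad, ?_⟩
  rintro Z ⟨φ, hφ, hZ⟩
  exact lnodeGrad_eq_zero_of_tendsto (hgrad.comp hφ.tendsto_atTop) hZ
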